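/- arXiv:2209.02195 — 3 statements merged into one kernel-verified Lean document; each statement's English description precedes it below -/
import Mathlib

section
/- Let M_1 = (S, 𝓘_1, ≻_1) and M_2 = (S, 𝓘_2, ≻_2) be ordered matroids on the same finite ground set S, and let M*_1 = (S*, 𝓘*_1, ≻*_1) and M*_2 = (S*, 𝓘*_2, ≻*_2) be the doubled instance. Suppose I* is an (M*_1, M*_2)-kernel and let I = π(I*). Then I ∈ 𝓘_1 ∩ 𝓘_2, and for every J ∈ 𝓘_1 ∩ 𝓘_2 and all pairings N_1, N_2 between I∖J and J∖I such that N_1 is a weakly feasible pairing for (I,J) with respect to M_1 and N_2 is a weakly feasible pairing for (I,J) with respect to M_2, we have vote_1(I, J, N_1) + vote_2(I, J, N_2) ≥ 0. Moreover, if |J| > |I|, then vote_1(I, J, N_1) + vote_2(I, J, N_2) > 0. -/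
open Finset
open scoped Classical

noncomputable section

/-- A matroid on the finite ground set `α`, given by its independence predicate on finsets. -/
structure FinMatroid (α : Type*) [DecidableEq α] where
  Indep : Finset α → Prop
  exists_indep : ∃ I, Indep I
  indep_subset : ∀ ⦃I J : Finset α⦄, I ⊆ J → Indep J → Indep I
  indep_exchange : ∀ ⦃I J : Finset α⦄, Indep I → Indep J → I.card < J.card →
    ∃ v ∈ J \ I, Indep (insert v I)

/-- `N` is a pairing between `I \ J` and `J \ I`: a set of pairwise disjoint pairs `(u, v)`
with `u ∈ I \ J` and `v ∈ J \ I`. -/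
def IsPairing {α : Type*} [DecidableEq α] (I J : Finset α) (N : Finset (α × α)) : Prop :=
  (∀ p ∈ N, p.1 ∈ I \ J ∧ p.2 ∈ J \ I) ∧
  (∀ p ∈ N, ∀ q ∈ N, p.1 = q.1 → p = q) ∧
  (∀ p ∈ N, ∀ q ∈ N, p.2 = q.2 → p = q)

/-- `N` is a weakly feasible pairing for `(I, J)`:
(1) `I - u + v` is independent for every `(u, v) ∈ N`, and
(2) every `v ∈ J \ I` with `I + v` dependent is covered by `N`. -/
def WeaklyFeasible {α : Type*} [DecidableEq α] (M : FinMatroid α) (I J : Finset α)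
    (N : Finset (α × α)) : Prop :=
  IsPairing I J N ∧
  (∀ p ∈ N, M.Indep (insert p.2 (I.erase p.1))) ∧
  (∀ v ∈ J \ I, ¬ M.Indep (insert v I) → ∃ p ∈ N, p.2 = v)

/-- `N` is a feasible pairing for `(I, J)` with respect to the direct-sum partition
`part : α → ι`: in addition to weak feasibility,
(3) every `u ∈ I \ J` with `J + u` dependent is covered by `N`,
(4) both entries of each pair lie in the same part, and
(5) for every part `j`, the number of pairs inside part `j` is
`min (|S_j ∩ (I \ J)|, |S_j ∩ (J \ I)|)`. -/
def Feasible {α ι : Type*} [DecidableEq α] (M : FinMatroid α) (part : α → ι)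
    (I J : Finset α) (N : Finset (α × α)) : Prop :=
  WeaklyFeasible M I J N ∧
  (∀ u ∈ I \ J, ¬ M.Indep (insert u J) → ∃ p ∈ N, p.1 = u) ∧
  (∀ p ∈ N, part p.1 = part p.2) ∧
  (∀ j : ι, (N.filter fun p => part p.1 = j).card =
    min (((I \ J).filter fun a => part a = j).card) (((J \ I).filter fun a => part a = j).card))

/-- `vote(I, J, N) = |{(u,v) ∈ N : u ≻ v}| - |{(u,v) ∈ N : v ≻ u}| + |I| - |J|`,
where `gt a b` means `a ≻ b`. -/
def voteN {α : Type*} (gt : α → α → Prop) (I J : Finset α) (N : Finset (α × α)) : ℤ :=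
  ((N.filter fun p => gt p.1 p.2).card : ℤ) - ((N.filter fun p => gt p.2 p.1).card : ℤ)
    + (I.card : ℤ) - (J.card : ℤ)

/-- `vote•(I, J)`: the minimum of `vote(I, J, N)` over weakly feasible pairings `N` for
`(I, J)`. -/
def voteB {α : Type*} [DecidableEq α] (M : FinMatroid α) (gt : α → α → Prop)
    (I J : Finset α) : ℤ :=
  sInf {z : ℤ | ∃ N : Finset (α × α), WeaklyFeasible M I J N ∧ z = voteN gt I J N}

/-- `vote(I, J)`: the minimum of `vote(I, J, N)` over feasible pairings `N` for `(I, J)`. -/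
def voteF {α ι : Type*} [DecidableEq α] (M : FinMatroid α) (gt : α → α → Prop)
    (part : α → ι) (I J : Finset α) : ℤ :=
  sInf {z : ℤ | ∃ N : Finset (α × α), Feasible M part I J N ∧ z = voteN gt I J N}

/-- The projection `π` from the doubled ground set `α × Bool` to `α`
(`(u, true)` is the `x`-copy `x(u)`, `(u, false)` is the `y`-copy `y(u)`). -/
def projStar {α : Type*} [DecidableEq α] (I : Finset (α × Bool)) : Finset α :=
  I.image Prod.fst

/-- Independence in the doubled instance `M*ᵢ`:
`π(I*) ∈ 𝓘ᵢ` and `I*` contains at most one copy of each element. -/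
def IndepStar {α : Type*} [DecidableEq α] (M : FinMatroid α) (I : Finset (α × Bool)) : Prop :=
  M.Indep (projStar I) ∧ ∀ u : α, ¬ ((u, true) ∈ I ∧ (u, false) ∈ I)

/-- The order `≻*₁` on copies: every `x`-copy is above every `y`-copy, and copies of the same
type are ordered by the underlying order (`gt a b` means `a ≻ b`). -/
def gtStarX {α : Type*} (gt : α → α → Prop) (p q : α × Bool) : Prop :=
  (p.2 = true ∧ q.2 = false) ∨ (p.2 = q.2 ∧ gt p.1 q.1)

/-- The order `≻*₂` on copies: every `y`-copy is above every `x`-copy, and copies of the same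
type are ordered by the underlying order. -/
def gtStarY {α : Type*} (gt : α → α → Prop) (p q : α × Bool) : Prop :=
  (p.2 = false ∧ q.2 = true) ∨ (p.2 = q.2 ∧ gt p.1 q.1)

/-- `v ∉ I` is dominated by `I` with respect to an independence predicate `Ind` and an order
`gt` (`gt a b` meaning `a ≻ b`): `I + v` is dependent and `u ≻ v` for every `u ∈ I` with
`I - u + v` independent. -/
def Dominated {β : Type*} [DecidableEq β] (Ind : Finset β → Prop) (gt : β → β → Prop)
    (I : Finset β) (v : β) : Prop :=
  ¬ Ind (insert v I) ∧ ∀ u ∈ I, Ind (insert v (I.erase u)) → gt u v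

/-- `I*` is an `(M*₁, M*₂)`-kernel of the doubled instance: it is independent in both doubled
matroids and every element outside `I*` is dominated by `I*` in `M*₁` or in `M*₂`. -/
def IsKernelStar {α : Type*} [DecidableEq α] (M₁ M₂ : FinMatroid α)
    (gt₁ gt₂ : α → α → Prop) (I : Finset (α × Bool)) : Prop :=
  IndepStar M₁ I ∧ IndepStar M₂ I ∧
  ∀ p : α × Bool, p ∉ I →
    Dominated (IndepStar M₁) (gtStarX gt₁) I p ∨ Dominated (IndepStar M₂) (gtStarY gt₂) I p

/-- `voteN` as a sum of signs over the pairs. -/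
lemma voteN_eq_sum {α : Type*} (gt : α → α → Prop) (I J : Finset α) (N : Finset (α × α)) :
    voteN gt I J N = ∑ p ∈ N, ((if gt p.1 p.2 then 1 else 0) - (if gt p.2 p.1 then 1 else 0) : ℤ)
      + I.card - J.card := by
  simp [voteN, Finset.sum_sub_distrib, Finset.sum_boole]

/-- The sign of a pair, plus `2` if its first entry satisfies `T`. -/
def pairWeight {α : Type*} (gt : α → α → Prop) (T : α → Prop) (p : α × α) : ℤ :=
  (if gt p.1 p.2 then 1 else 0) - (if gt p.2 p.1 then 1 else 0) + (if T p.1 then 2 else 0)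

/-- The total weight of the pairs of `N` whose second entry is `v`. -/
def coverWeight {α : Type*} [DecidableEq α] (gt : α → α → Prop) (T : α → Prop)
    (N : Finset (α × α)) (v : α) : ℤ :=
  ∑ p ∈ N with p.2 = v, pairWeight gt T p

lemma neg_one_le_pairWeight {α : Type*} (gt : α → α → Prop) (T : α → Prop) (p : α × α) :
    -1 ≤ pairWeight gt T p := by
  unfold pairWeight
  split_ifs <;> norm_num

lemma IsPairing.coverWeight_eq {α : Type*} [DecidableEq α] {I J : Finset α}
    {N : Finset (α × α)} (hN : IsPairing I J N) (gt : α → α → Prop) (T : α → Prop)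
    {p : α × α} (hp : p ∈ N) : coverWeight gt T N p.2 = pairWeight gt T p := by
  have h : N.filter (fun q => q.2 = p.2) = {p} := by
    ext q
    simp only [Finset.mem_filter, Finset.mem_singleton]
    refine ⟨fun h => hN.2.2 q h.1 p hp h.2, ?_⟩
    rintro rfl
    exact ⟨hp, rfl⟩
  rw [coverWeight, h, Finset.sum_singleton]

lemma coverWeight_eq_zero {α : Type*} [DecidableEq α] (gt : α → α → Prop) (T : α → Prop)
    {N : Finset (α × α)} {v : α} (h : ∀ p ∈ N, p.2 ≠ v) : coverWeight gt T N v = 0 := by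
  rw [coverWeight, Finset.filter_false_of_mem h, Finset.sum_empty]

lemma IsPairing.neg_one_le_coverWeight {α : Type*} [DecidableEq α] {I J : Finset α}
    {N : Finset (α × α)} (hN : IsPairing I J N) (gt : α → α → Prop) (T : α → Prop) (v : α) :
    -1 ≤ coverWeight gt T N v := by
  by_cases h : ∃ p ∈ N, p.2 = v
  · obtain ⟨p, hp, rfl⟩ := h
    rw [hN.coverWeight_eq gt T hp]
    exact neg_one_le_pairWeight gt T p
  · push Not at h
    rw [coverWeight_eq_zero gt T h]
    norm_num

/-- The vote is bounded below by the total cover weight, up to the elements of `I \ J`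
satisfying `T`. -/
lemma IsPairing.sum_coverWeight_le {α : Type*} [DecidableEq α] {I J : Finset α}
    {N : Finset (α × α)} (hN : IsPairing I J N) (gt : α → α → Prop) (T : α → Prop) :
    ∑ v ∈ J \ I, coverWeight gt T N v
      ≤ voteN gt I J N - I.card + J.card + 2 * ((I \ J).filter T).card := by
  have hfib : ∑ v ∈ J \ I, coverWeight gt T N v = ∑ p ∈ N, pairWeight gt T p :=
    Finset.sum_fiberwise_of_maps_to (fun p hp => (hN.1 p hp).2) _
  have hcard : (N.filter fun p => T p.1).card ≤ ((I \ J).filter T).card := by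
    apply Finset.card_le_card_of_injOn Prod.fst
    · intro p hp
      simp only [Finset.coe_filter, Set.mem_ofPred_eq] at hp ⊢
      exact ⟨(hN.1 p hp.1).1, hp.2⟩
    · intro p hp q hq h
      simp only [Finset.coe_filter, Set.mem_ofPred_eq] at hp hq
      exact hN.2.1 p hp.1 q hq.1 h
  have hT : ∑ p ∈ N, (if T p.1 then 2 else 0 : ℤ) = 2 * (N.filter fun p => T p.1).card := by
    rw [← Finset.sum_filter, Finset.sum_const, nsmul_eq_mul, mul_comm]
  rw [hfib, voteN_eq_sum]
  simp only [pairWeight]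
  rw [Finset.sum_add_distrib, hT]
  have : ((N.filter fun p => T p.1).card : ℤ) ≤ ((I \ J).filter T).card := by
    exact_mod_cast hcard
  linarith

/-- If `I + v` is dependent and every `u` exchangeable with `v` satisfies `T` or `u ≻ v`, then
the weight at `v` is at least `1`. -/
lemma WeaklyFeasible.one_le_coverWeight {α : Type*} [DecidableEq α] {M : FinMatroid α}
    {gt : α → α → Prop} (hgt : IsStrictTotalOrder α gt) {T : α → Prop} {I J : Finset α}
    {N : Finset (α × α)} (hN : WeaklyFeasible M I J N) {v : α} (hv : v ∈ J \ I)
    (hdep : ¬ M.Indep (insert v I))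
    (hdom : ∀ u ∈ I, M.Indep (insert v (I.erase u)) → T u ∨ gt u v) :
    1 ≤ coverWeight gt T N v := by
  obtain ⟨p, hp, rfl⟩ := hN.2.2 v hv hdep
  rw [hN.1.coverWeight_eq gt T hp]
  have hpI := (Finset.mem_sdiff.1 (hN.1.1 p hp).1).1
  rcases hdom p.1 hpI (hN.2.1 p hp) with h | h
  · unfold pairWeight
    split_ifs <;> norm_num
  · have h' : ¬ gt p.2 p.1 := fun h' => hgt.irrefl _ (hgt.trans _ _ _ h h')
    unfold pairWeight
    split_ifs <;> norm_num

/-- If `I + v` is dependent and every `u` exchangeable with `v` satisfies `T` and `u ≻ v`, then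
the weight at `v` is at least `3`. -/
lemma WeaklyFeasible.three_le_coverWeight {α : Type*} [DecidableEq α] {M : FinMatroid α}
    {gt : α → α → Prop} (hgt : IsStrictTotalOrder α gt) {T : α → Prop} {I J : Finset α}
    {N : Finset (α × α)} (hN : WeaklyFeasible M I J N) {v : α} (hv : v ∈ J \ I)
    (hdep : ¬ M.Indep (insert v I))
    (hdom : ∀ u ∈ I, M.Indep (insert v (I.erase u)) → T u ∧ gt u v) :
    3 ≤ coverWeight gt T N v := by
  obtain ⟨p, hp, rfl⟩ := hN.2.2 v hv hdep
  rw [hN.1.coverWeight_eq gt T hp]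
  have hpI := (Finset.mem_sdiff.1 (hN.1.1 p hp).1).1
  obtain ⟨hT, h⟩ := hdom p.1 hpI (hN.2.1 p hp)
  have h' : ¬ gt p.2 p.1 := fun h' => hgt.irrefl _ (hgt.trans _ _ _ h h')
  simp [pairWeight, h, h', hT]

lemma mem_projStar {α : Type*} [DecidableEq α] {I : Finset (α × Bool)} {u : α} :
    u ∈ projStar I ↔ ∃ b, (u, b) ∈ I := by
  simp [projStar]

/-- Domination of a copy of `v` in the doubled matroid, read off in the original matroid. -/
lemma Dominated.of_indepStar {α : Type*} [DecidableEq α] {M : FinMatroid α}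
    {gt : α × Bool → α × Bool → Prop} {I : Finset (α × Bool)} (hI : IndepStar M I) {v : α}
    {c : Bool} (hv : v ∉ projStar I) (hdom : Dominated (IndepStar M) gt I (v, c)) :
    ¬ M.Indep (insert v (projStar I)) ∧
    ∀ u ∈ projStar I, M.Indep (insert v ((projStar I).erase u)) →
      ∃ b, (u, b) ∈ I ∧ gt (u, b) (v, c) := by
  have hvI : ∀ b, (v, b) ∉ I := fun b hb => hv (mem_projStar.2 ⟨b, hb⟩)
  have hcopies : ∀ K ⊆ I, ∀ w, ¬ ((w, true) ∈ insert (v, c) K ∧ (w, false) ∈ insert (v, c) K) := by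
    rintro K hK w ⟨ht, hf⟩
    simp only [Finset.mem_insert, Prod.mk.injEq] at ht hf
    rcases ht with ⟨rfl, ht⟩ | ht <;> rcases hf with ⟨hw, hf⟩ | hf
    · exact absurd (ht.trans hf.symm) (by decide)
    · exact hvI _ (hK hf)
    · exact hvI _ (hw ▸ hK ht)
    · exact hI.2 w ⟨hK ht, hK hf⟩
  refine ⟨fun h => hdom.1 ⟨?_, hcopies I subset_rfl⟩, fun u hu h => ?_⟩
  · simpa [projStar, Finset.image_insert] using h
  · obtain ⟨b, hb⟩ := mem_projStar.1 hu
    refine ⟨b, hb, hdom.2 _ hb ⟨M.indep_subset ?_ h, hcopies _ (Finset.erase_subset _ _)⟩⟩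
    intro w hw
    obtain ⟨d, hd⟩ := mem_projStar.1 hw
    simp only [Finset.mem_insert, Finset.mem_erase, Prod.mk.injEq, ne_eq] at hd ⊢
    rcases hd with ⟨rfl, -⟩ | ⟨hne, hd⟩
    · exact Or.inl rfl
    · refine Or.inr ⟨?_, mem_projStar.2 ⟨d, hd⟩⟩
      rintro rfl
      have := hI.2 w
      cases b <;> cases d <;> simp_all

/-- if `I*` is an `(M*₁, M*₂)`-kernel of the doubled instance and `I = π(I*)`,
then `I` is a common independent set, and for every common independent set `J` and all weakly
feasible pairings `N₁` (w.r.t. `M₁`) and `N₂` (w.r.t. `M₂`) for `(I, J)` we have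
`vote₁(I,J,N₁) + vote₂(I,J,N₂) ≥ 0`; moreover if `|J| > |I|` the inequality is strict.
(`gtᵢ a b` means `a ≻ᵢ b`.) -/
theorem stmt_7 {α : Type*} [DecidableEq α] [Fintype α]
    (M₁ M₂ : FinMatroid α) (gt₁ gt₂ : α → α → Prop)
    (h₁ : IsStrictTotalOrder α gt₁) (h₂ : IsStrictTotalOrder α gt₂)
    (Istar : Finset (α × Bool)) (hker : IsKernelStar M₁ M₂ gt₁ gt₂ Istar) :
    M₁.Indep (projStar Istar) ∧ M₂.Indep (projStar Istar) ∧
    ∀ J : Finset α, M₁.Indep J → M₂.Indep J →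
      ∀ N₁ N₂ : Finset (α × α),
        WeaklyFeasible M₁ (projStar Istar) J N₁ →
        WeaklyFeasible M₂ (projStar Istar) J N₂ →
        0 ≤ voteN gt₁ (projStar Istar) J N₁ + voteN gt₂ (projStar Istar) J N₂ ∧
        ((projStar Istar).card < J.card →
          0 < voteN gt₁ (projStar Istar) J N₁ + voteN gt₂ (projStar Istar) J N₂) := by
  obtain ⟨hI₁, hI₂, hdom⟩ := hker
  refine ⟨hI₁.1, hI₂.1, fun J _ _ N₁ N₂ hN₁ hN₂ => ?_⟩
  set I := projStar Istar
  obtain ⟨T₁, hT₁⟩ : ∃ T : α → Prop, ∀ u, T u ↔ (u, true) ∈ Istar := ⟨_, fun _ => Iff.rfl⟩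
  obtain ⟨T₂, hT₂⟩ : ∃ T : α → Prop, ∀ u, T u ↔ (u, false) ∈ Istar := ⟨_, fun _ => Iff.rfl⟩
  have key : ∀ v ∈ J \ I,
      2 ≤ coverWeight gt₁ T₁ N₁ v + coverWeight gt₂ T₂ N₂ v ∧
      ((∀ p ∈ N₁, p.2 ≠ v) → 3 ≤ coverWeight gt₁ T₁ N₁ v + coverWeight gt₂ T₂ N₂ v) := by
    intro v hv
    have hvI : v ∉ projStar Istar := (Finset.mem_sdiff.1 hv).2
    have hvb : ∀ b, (v, b) ∉ Istar := fun b hb => hvI (mem_projStar.2 ⟨b, hb⟩)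
    have low₁ := hN₁.1.neg_one_le_coverWeight gt₁ T₁ v
    have low₂ := hN₂.1.neg_one_le_coverWeight gt₂ T₂ v
    have uncovered : (∀ p ∈ N₁, p.2 ≠ v) → coverWeight gt₁ T₁ N₁ v = 0 :=
      coverWeight_eq_zero gt₁ T₁
    have hx : 3 ≤ coverWeight gt₁ T₁ N₁ v ∨ 1 ≤ coverWeight gt₂ T₂ N₂ v := by
      refine (hdom (v, true) (hvb _)).imp (fun h => ?_) (fun h => ?_)
      · obtain ⟨hdep, h⟩ := h.of_indepStar hI₁ hvI
        refine hN₁.three_le_coverWeight h₁ hv hdep fun u hu hex => ?_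
        obtain ⟨b, hb, hgt⟩ := h u hu hex
        cases b <;> simp_all [gtStarX]
      · obtain ⟨hdep, h⟩ := h.of_indepStar hI₂ hvI
        refine hN₂.one_le_coverWeight h₂ hv hdep fun u hu hex => ?_
        obtain ⟨b, hb, hgt⟩ := h u hu hex
        cases b <;> simp_all [gtStarY]
    have hy : 1 ≤ coverWeight gt₁ T₁ N₁ v ∨ 3 ≤ coverWeight gt₂ T₂ N₂ v := by
      refine (hdom (v, false) (hvb _)).imp (fun h => ?_) (fun h => ?_)
      · obtain ⟨hdep, h⟩ := h.of_indepStar hI₁ hvI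
        refine hN₁.one_le_coverWeight h₁ hv hdep fun u hu hex => ?_
        obtain ⟨b, hb, hgt⟩ := h u hu hex
        cases b <;> simp_all [gtStarX]
      · obtain ⟨hdep, h⟩ := h.of_indepStar hI₂ hvI
        refine hN₂.three_le_coverWeight h₂ hv hdep fun u hu hex => ?_
        obtain ⟨b, hb, hgt⟩ := h u hu hex
        cases b <;> simp_all [gtStarY]
    refine ⟨by omega, fun h => ?_⟩
    have := uncovered h
    omega
  have hle₁ := hN₁.1.sum_coverWeight_le gt₁ T₁
  have hle₂ := hN₂.1.sum_coverWeight_le gt₂ T₂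
  have htypes : ((I \ J).filter T₁).card + ((I \ J).filter T₂).card = (I \ J).card := by
    have : (I \ J).filter T₂ = (I \ J).filter fun u => ¬ T₁ u := by
      refine Finset.filter_congr fun u hu => ?_
      obtain ⟨b, hb⟩ := mem_projStar.1 (Finset.mem_sdiff.1 hu).1
      have := hI₁.2 u
      cases b <;> simp_all
    rw [this]
    exact Finset.card_filter_add_card_filter_not T₁
  have hIJ := Finset.card_sdiff_add_card_inter I J
  have hJI := Finset.card_sdiff_add_card_inter J I
  rw [Finset.inter_comm J I] at hJI
  have htwo : ∑ _v ∈ J \ I, (2 : ℤ) = 2 * (J \ I).card := by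
    rw [Finset.sum_const, nsmul_eq_mul, mul_comm]
  refine ⟨?_, fun hlt => ?_⟩
  · have hsum := Finset.sum_le_sum fun v hv => (key v hv).1
    rw [Finset.sum_add_distrib, htwo] at hsum
    omega
  · have hcov : ∃ v ∈ J \ I, ∀ p ∈ N₁, p.2 ≠ v := by
      by_contra! hcov
      have hJN : (J \ I).card ≤ N₁.card := by
        refine (Finset.card_le_card fun v hv => ?_).trans (Finset.card_image_le (f := Prod.snd))
        obtain ⟨p, hp, hpv⟩ := hcov v hv
        exact Finset.mem_image.2 ⟨p, hp, hpv⟩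
      have hNI : N₁.card ≤ (I \ J).card :=
        Finset.card_le_card_of_injOn Prod.fst (fun p hp => (hN₁.1.1 p hp).1)
          fun p hp q hq h => hN₁.1.2.1 p hp q hq h
      omega
    obtain ⟨v, hv, hun⟩ := hcov
    have hsum := Finset.sum_lt_sum (fun v hv => (key v hv).1)
      ⟨v, hv, by linarith [(key v hv).2 hun]⟩
    rw [Finset.sum_add_distrib, htwo] at hsum
    omega

end
end

section
/- Let M_1 = (S, 𝓘_1, ≻_1) and M_2 = (S, 𝓘_2, ≻_2) be ordered matroids on the same finite ground set S. Then there exists a common independent set I ∈ 𝓘_1 ∩ 𝓘_2 such that (a) I is super popular, i.e., vote•_1(I,J) + vote•_2(I,J) ≥ 0 for every J ∈ 𝓘_1 ∩ 𝓘_2, and (b) every weakly defendable common independent set J ∈ 𝓘_1 ∩ 𝓘_2 satisfies |J| ≤ |I|. -/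
open Finset
open scoped Classical

noncomputable section

namespace FinMatroid

variable {α : Type*} [DecidableEq α]

theorem indep_empty (M : FinMatroid α) : M.Indep ∅ := by
  obtain ⟨I, hI⟩ := M.exists_indep
  exact M.indep_subset (empty_subset I) hI

/-- An independent set can be augmented from a larger one up to the size of the latter. -/
theorem exists_augment (M : FinMatroid α) {A B : Finset α} (hA : M.Indep A) (hB : M.Indep B)
    (hcard : A.card ≤ B.card) :
    ∃ C, A ⊆ C ∧ C ⊆ A ∪ B ∧ C.card = B.card ∧ M.Indep C := by
  induction hn : B.card - A.card generalizing A with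
  | zero => exact ⟨A, Subset.rfl, subset_union_left, by omega, hA⟩
  | succ n ih =>
    obtain ⟨v, hv, hvA⟩ := M.indep_exchange hA hB (by omega)
    rw [mem_sdiff] at hv
    have hc := card_insert_of_notMem hv.2
    obtain ⟨C, hAC, hCB, hCc, hC⟩ := ih hvA (by omega) (by omega)
    refine ⟨C, (subset_insert v A).trans hAC, hCB.trans ?_, hCc, hC⟩
    intro x hx
    grind

/-- `I` dominates `v` if `I + v` is dependent and every element that `v` could replace is
preferred to `v`. -/
def Dominates (M : FinMatroid α) (gt : α → α → Prop) (I : Finset α) (v : α) : Prop :=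
  ¬ M.Indep (insert v I) ∧ ∀ u ∈ I, M.Indep (insert v (I.erase u)) → gt u v

/-- The elements of `X` that are not spanned by the strictly better elements of `X`. -/
def choice (M : FinMatroid α) (gt : α → α → Prop) (X : Finset α) : Finset α :=
  X.filter fun v => ∀ B ⊆ X.filter (gt · v), M.Indep B → M.Indep (insert v B)

theorem choice_subset (M : FinMatroid α) (gt : α → α → Prop) (X : Finset α) :
    M.choice gt X ⊆ X :=
  filter_subset _ _

theorem sdiff_choice_mono (M : FinMatroid α) (gt : α → α → Prop) {X Y : Finset α} (h : X ⊆ Y) :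
    X \ M.choice gt X ⊆ Y \ M.choice gt Y := by
  intro v hv
  simp only [choice, mem_sdiff, mem_filter, not_and] at hv ⊢
  exact ⟨h hv.1, fun _ hY => hv.2 hv.1 fun B hB => hY B (hB.trans (filter_subset_filter _ h))⟩

theorem exists_least (gt : α → α → Prop) [IsStrictTotalOrder α gt] {B : Finset α}
    (hB : B.Nonempty) : ∃ v ∈ B, ∀ u ∈ B.erase v, gt u v := by
  induction hB using Finset.Nonempty.cons_induction with
  | singleton a => exact ⟨a, by simp, by simp⟩
  | cons a s ha hs ih =>
    obtain ⟨v, hv, hmin⟩ := ih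
    rcases trichotomous_of gt a v with h | h | h
    · exact ⟨v, by simp [hv], by grind⟩
    · exact absurd (h ▸ hv) ha
    · refine ⟨a, by simp, fun u hu => ?_⟩
      have hus : u ∈ s := by grind
      by_cases huv : u = v
      · exact huv ▸ h
      · exact trans_of gt (hmin u (mem_erase.2 ⟨huv, hus⟩)) h

theorem indep_of_subset_choice (M : FinMatroid α) (gt : α → α → Prop) [IsStrictTotalOrder α gt]
    {X B : Finset α} (hB : B ⊆ M.choice gt X) : M.Indep B := by
  induction B using Finset.strongInduction with
  | H B ih =>
    rcases B.eq_empty_or_nonempty with rfl | hne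
    · exact M.indep_empty
    obtain ⟨v, hv, hmin⟩ := exists_least gt hne
    have hsub := (erase_subset v B).trans hB
    have hvX := (mem_filter.1 (hB hv)).2 (B.erase v)
      (fun u hu => mem_filter.2 ⟨M.choice_subset gt X (hsub hu), hmin u hu⟩)
      (ih _ (erase_ssubset hv) hsub)
    rwa [insert_erase hv] at hvX

theorem not_indep_insert_choice_filter [Finite α] (M : FinMatroid α) (gt : α → α → Prop)
    [IsStrictTotalOrder α gt] {X : Finset α} {v : α} (hvX : v ∈ X) (hv : v ∉ M.choice gt X) :
    ¬ M.Indep (insert v ((M.choice gt X).filter (gt · v))) := by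
  induction v using (Finite.wellFounded_of_trans_of_irrefl gt).induction with
  | _ v ih =>
    intro hind
    set A := (M.choice gt X).filter (gt · v) with hA
    obtain ⟨B, hBX, hB, hBv⟩ : ∃ B ⊆ X.filter (gt · v), M.Indep B ∧ ¬ M.Indep (insert v B) := by
      by_contra! h
      exact hv (mem_filter.2 ⟨hvX, h⟩)
    have hmax : ∀ w ∈ X.filter (gt · v), w ∉ A → ¬ M.Indep (insert w A) := by
      intro w hw hwA hwind
      rw [mem_filter] at hw
      have hwC : w ∉ M.choice gt X := fun h => hwA (mem_filter.2 ⟨h, hw.2⟩)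
      refine ih w hw.2 hw.1 hwC (M.indep_subset (insert_subset_insert w ?_) hwind)
      exact fun u hu => mem_filter.2
        ⟨(mem_filter.1 hu).1, trans_of gt (mem_filter.1 hu).2 hw.2⟩
    have hAind : M.Indep A := M.indep_subset (subset_insert v A) hind
    have hbound : ∀ C ⊆ X.filter (gt · v), M.Indep C → C.card ≤ A.card := by
      intro C hCX hC
      by_contra! hlt
      obtain ⟨w, hw, hwind⟩ := M.indep_exchange hAind hC hlt
      rw [mem_sdiff] at hw
      exact hmax w (hCX hw.1) hw.2 hwind
    have hvA : v ∉ A := fun h => hv (mem_filter.1 h).1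
    have hAX : A ⊆ X.filter (gt · v) := filter_subset_filter _ (M.choice_subset gt X)
    have hcard := card_insert_of_notMem hvA
    obtain ⟨C, hBC, hCAB, hCc, hC⟩ := M.exists_augment hB hind (by have := hbound B hBX hB; omega)
    have hvC : v ∉ C := fun h => hBv (M.indep_subset (insert_subset h hBC) hC)
    have hCX : C ⊆ X.filter (gt · v) := by
      intro x hx
      have := hCAB hx
      rw [mem_union, mem_insert] at this
      rcases this with h | h | h
      · exact hBX h
      · exact absurd (h ▸ hx) hvC
      · exact hAX h
    have := hbound C hCX hC
    omega

theorem dominates_choice [Finite α] (M : FinMatroid α) (gt : α → α → Prop)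
    [IsStrictTotalOrder α gt] {X : Finset α} {v : α} (hvX : v ∈ X) (hv : v ∉ M.choice gt X) :
    M.Dominates gt (M.choice gt X) v := by
  have hdep := M.not_indep_insert_choice_filter gt hvX hv
  refine ⟨fun h => hdep (M.indep_subset (insert_subset_insert v (filter_subset _ _)) h), ?_⟩
  intro u _ hind
  by_contra hgt
  refine hdep (M.indep_subset (insert_subset_insert v fun w hw => ?_) hind)
  rw [mem_filter] at hw
  exact mem_erase.2 ⟨fun h => hgt (h ▸ hw.2), hw.1⟩

/-- Two ordered matroids on a finite ground set have a stable common independent set. -/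
theorem exists_stable [Fintype α] (M₁ M₂ : FinMatroid α) (gt₁ gt₂ : α → α → Prop)
    [IsStrictTotalOrder α gt₁] [IsStrictTotalOrder α gt₂] :
    ∃ I, M₁.Indep I ∧ M₂.Indep I ∧
      ∀ v ∉ I, M₁.Dominates gt₁ I v ∨ M₂.Dominates gt₂ I v := by
  let R₁ : Finset α → Finset α := fun X => X \ M₁.choice gt₁ X
  let R₂ : Finset α → Finset α := fun X => X \ M₂.choice gt₂ X
  let F : Finset α →o Finset α :=
    { toFun := fun X => (R₂ (R₁ X)ᶜ)ᶜ
      monotone' := fun X Y h => compl_le_compl (M₂.sdiff_choice_mono gt₂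
        (compl_le_compl (M₁.sdiff_choice_mono gt₁ h))) }
  obtain ⟨X, hX⟩ : ∃ X, F X = X := by
    obtain ⟨X, hX⟩ := (Set.toFinite {X | X ≤ F X}).exists_maximal ⟨∅, empty_subset _⟩
    exact ⟨X, le_antisymm (hX.2 (F.monotone hX.1) hX.1) hX.1⟩
  obtain ⟨Y, hY⟩ : ∃ Y, Y = (R₁ X)ᶜ := ⟨_, rfl⟩
  have hXY : X = (R₂ Y)ᶜ := by rw [hY]; exact hX.symm
  have h₁ : M₁.choice gt₁ X = X ∩ Y := by
    have := M₁.choice_subset gt₁ X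
    ext v
    simp only [hY, R₁, mem_inter, mem_compl, mem_sdiff]
    grind
  have h₂ : M₂.choice gt₂ Y = X ∩ Y := by
    have := M₂.choice_subset gt₂ Y
    ext v
    simp only [hXY, R₂, mem_inter, mem_compl, mem_sdiff]
    grind
  refine ⟨X ∩ Y, h₁ ▸ M₁.indep_of_subset_choice gt₁ Subset.rfl,
    h₂ ▸ M₂.indep_of_subset_choice gt₂ Subset.rfl, fun v hv => ?_⟩
  by_cases hvX : v ∈ X
  · left
    rw [← h₁] at hv ⊢
    exact M₁.dominates_choice gt₁ hvX hv
  · right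
    have hvY : v ∈ Y := by
      by_contra hvY
      rw [hXY, mem_compl, not_not] at hvX
      exact hvY (mem_sdiff.1 hvX).1
    rw [← h₂] at hv ⊢
    exact M₂.dominates_choice gt₂ hvY hv

/-- The matroid obtained by replacing each element by two parallel copies. -/
def double (M : FinMatroid α) : FinMatroid (α × Bool) where
  Indep A := Set.InjOn Prod.fst (A : Set (α × Bool)) ∧ M.Indep (A.image Prod.fst)
  exists_indep := ⟨∅, by simp, by simpa using M.indep_empty⟩
  indep_subset := fun _ _ h hJ =>
    ⟨hJ.1.mono (coe_subset.2 h), M.indep_subset (image_subset_image h) hJ.2⟩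
  indep_exchange := fun A B hA hB hcard => by
    rw [← card_image_of_injOn hA.1, ← card_image_of_injOn hB.1] at hcard
    obtain ⟨v, hv, hind⟩ := M.indep_exchange hA.2 hB.2 hcard
    rw [mem_sdiff, mem_image] at hv
    obtain ⟨⟨p, hpB, rfl⟩, hpA⟩ := hv
    have hp : p ∉ A := fun h => hpA (mem_image_of_mem _ h)
    refine ⟨p, mem_sdiff.2 ⟨hpB, hp⟩, ?_, by rwa [image_insert]⟩
    rw [coe_insert, Set.injOn_insert (by simpa using hp)]
    exact ⟨hA.1, by simpa using hpA⟩

/-- The order on two copies of each element in which copies with label `l` come first. -/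
def doubleGt (gt : α → α → Prop) (l : Bool) (p q : α × Bool) : Prop :=
  (p.2 = l ∧ q.2 ≠ l) ∨ (p.2 = q.2 ∧ gt p.1 q.1)

instance doubleGt_isStrictTotalOrder (gt : α → α → Prop) [IsStrictTotalOrder α gt] (l : Bool) :
    IsStrictTotalOrder (α × Bool) (doubleGt gt l) where
  irrefl := by
    rintro ⟨x, b⟩ (h | h)
    · exact h.2 h.1
    · exact irrefl_of gt x h.2
  trans := by
    rintro ⟨x, b⟩ ⟨y, c⟩ ⟨z, d⟩ h h'
    have := fun h h' => trans_of gt (a := x) (b := y) (c := z) h h'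
    simp only [doubleGt] at *
    grind
  trichotomous := by
    rintro ⟨x, b⟩ ⟨y, c⟩ h h'
    have := trichotomous_of gt x y
    simp only [doubleGt, Prod.mk.injEq] at *
    cases b <;> cases c <;> cases l <;> grind

theorem double_dominates {M : FinMatroid α} {gt : α → α → Prop} {l : Bool}
    {A : Finset (α × Bool)} (hA : M.double.Indep A) {v : α} {b : Bool}
    (hv : v ∉ A.image Prod.fst) (h : M.double.Dominates (doubleGt gt l) A (v, b)) :
    ¬ M.Indep (insert v (A.image Prod.fst)) ∧
      ∀ p ∈ A, M.Indep (insert v ((A.image Prod.fst).erase p.1)) → doubleGt gt l p (v, b) := by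
  have key : ∀ B ⊆ A, M.Indep (insert v (B.image Prod.fst)) →
      M.double.Indep (insert (v, b) B) := by
    intro B hBA hB
    refine ⟨?_, by rwa [image_insert]⟩
    have hvB : v ∉ B.image Prod.fst := fun h => hv (image_subset_image hBA h)
    rw [coe_insert, Set.injOn_insert fun h => hvB (mem_image_of_mem _ h)]
    exact ⟨hA.1.mono (coe_subset.2 hBA), by simpa using hvB⟩
  refine ⟨fun hind => h.1 (key A Subset.rfl hind), fun p hp hind => h.2 p hp ?_⟩
  refine key _ (erase_subset p A) (M.indep_subset (insert_subset_insert v fun x hx => ?_) hind)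
  obtain ⟨q, hq, rfl⟩ := mem_image.1 hx
  rw [mem_erase] at hq
  exact mem_erase.2 ⟨fun heq => hq.1 (hA.1 hq.2 hp heq), mem_image_of_mem _ hq.2⟩

theorem exists_weaklyFeasible (M : FinMatroid α) {I J : Finset α} (hI : M.Indep I)
    (hJ : M.Indep J) : ∃ N, WeaklyFeasible M I J N := by
  let D := (J \ I).filter fun v => ¬ M.Indep (insert v I)
  let t : D → Finset α := fun v => (I \ J).filter fun u => M.Indep (insert v.1 (I.erase u))
  have hall : ∀ X : Finset D, X.card ≤ (X.biUnion t).card := by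
    intro X
    by_contra! hlt
    set U := X.biUnion t with hU
    have hUI : U ⊆ I \ J := biUnion_subset.2 fun v _ => filter_subset _ _
    let X' : Finset α := X.map (Function.Embedding.subtype _)
    have hX' : ∀ x ∈ X', ∃ h : x ∈ D, ⟨x, h⟩ ∈ X := by
      intro x hx
      simpa [X'] using hx
    have hX'J : ∀ x ∈ X', x ∈ J ∧ x ∉ I := fun x hx =>
      mem_sdiff.1 (mem_filter.1 (hX' x hx).1).1
    have hA : M.Indep (I ∩ J ∪ U) := M.indep_subset (by grind) hI
    have hB : M.Indep (I ∩ J ∪ X') := M.indep_subset (by grind) hJ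
    have hAc : (I ∩ J ∪ U).card = (I ∩ J).card + U.card :=
      card_union_of_disjoint (by rw [disjoint_left]; grind)
    have hBc : (I ∩ J ∪ X').card = (I ∩ J).card + X'.card :=
      card_union_of_disjoint (by rw [disjoint_left]; grind)
    have hXc : X'.card = X.card := card_map _
    obtain ⟨v, hv, hvind⟩ := M.indep_exchange hA hB (by omega)
    have hvX : v ∈ X' := by grind
    have hvI := (hX'J v hvX).2
    obtain ⟨hvD, hvX⟩ := hX' v hvX
    have hdep := (mem_filter.1 hvD).2
    have hAI : I ∩ J ∪ U ⊆ I := by grind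
    have hAlt : (I ∩ J ∪ U).card < I.card := by
      by_contra! hge
      exact hdep (eq_of_subset_of_card_le hAI hge ▸ hvind)
    have hvc := card_insert_of_notMem (fun h => hvI (hAI h) : v ∉ I ∩ J ∪ U)
    obtain ⟨C, hAC, hCI, hCc, hC⟩ := M.exists_augment hvind hI (by omega)
    have hvC : v ∈ C := hAC (mem_insert_self _ _)
    have hex : ∃ u ∈ I, u ∉ C := by
      by_contra! h
      exact hdep (M.indep_subset (insert_subset hvC h) hC)
    obtain ⟨u, huI, huC⟩ := hex
    have hCeq : C = insert v (I.erase u) := by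
      refine eq_of_subset_of_card_le (fun x hx => ?_) ?_
      · have := hCI hx
        grind
      · rw [card_insert_of_notMem (fun h => hvI (mem_of_mem_erase h)), card_erase_of_mem huI]
        have := card_pos.2 ⟨u, huI⟩
        omega
    have huJ : u ∉ J := fun h => huC (hAC (by simp [huI, h]))
    have huU : u ∈ U := mem_biUnion.2
      ⟨⟨v, hvD⟩, hvX, mem_filter.2 ⟨mem_sdiff.2 ⟨huI, huJ⟩, hCeq ▸ hC⟩⟩
    exact huC (hAC (by simp [huU]))
  obtain ⟨f, hf, hft⟩ := (Finset.all_card_le_biUnion_card_iff_exists_injective t).1 hall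
  have hft' := fun v => mem_filter.1 (hft v)
  refine ⟨univ.image fun v : D => (f v, v.1), ⟨?_, ?_, ?_⟩, ?_, ?_⟩
  · intro p hp
    obtain ⟨v, -, rfl⟩ := mem_image.1 hp
    exact ⟨(hft' v).1, (mem_filter.1 v.2).1⟩
  · intro p hp q hq h
    obtain ⟨v, -, rfl⟩ := mem_image.1 hp
    obtain ⟨w, -, rfl⟩ := mem_image.1 hq
    rw [hf h]
  · intro p hp q hq h
    obtain ⟨v, -, rfl⟩ := mem_image.1 hp
    obtain ⟨w, -, rfl⟩ := mem_image.1 hq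
    rw [Subtype.ext h]
  · intro p hp
    obtain ⟨v, -, rfl⟩ := mem_image.1 hp
    exact (hft' v).2
  · intro v hv hdep
    exact ⟨_, mem_image.2 ⟨⟨v, mem_filter.2 ⟨hv, hdep⟩⟩, mem_univ _, rfl⟩, rfl⟩

theorem exists_voteB_eq [Fintype α] (M : FinMatroid α) (gt : α → α → Prop) {I J : Finset α}
    (hI : M.Indep I) (hJ : M.Indep J) :
    ∃ N, WeaklyFeasible M I J N ∧ voteB M gt I J = voteN gt I J N := by
  obtain ⟨N, hN⟩ := M.exists_weaklyFeasible hI hJ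
  refine Int.csInf_mem (s := {z : ℤ | ∃ N, WeaklyFeasible M I J N ∧ z = voteN gt I J N})
    ⟨_, N, hN, rfl⟩ ?_
  refine (Set.Finite.subset (Set.finite_range (voteN gt I J)) ?_).bddBelow
  rintro _ ⟨N, -, rfl⟩
  exact ⟨N, rfl⟩

end FinMatroid

section Counting

variable {α : Type*}

/-- The vote of the pair `p` in favour of its first entry. -/
def pairVote (gt : α → α → Prop) (p : α × α) : ℤ :=
  (if gt p.1 p.2 then 1 else 0) - (if gt p.2 p.1 then 1 else 0)

theorem neg_one_le_pairVote (gt : α → α → Prop) (p : α × α) : -1 ≤ pairVote gt p := by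
  unfold pairVote
  split_ifs <;> simp

theorem pairVote_of_gt {gt : α → α → Prop} [IsStrictTotalOrder α gt] {p : α × α}
    (h : gt p.1 p.2) : pairVote gt p = 1 := by
  simp [pairVote, h, asymm_of gt h]

variable [DecidableEq α]

/-- The total of `pairVote gt p + g p.1` over the pairs of `N` ending in `v`. -/
def score (gt : α → α → Prop) (g : α → ℤ) (N : Finset (α × α)) (v : α) : ℤ :=
  ∑ p ∈ N with p.2 = v, (pairVote gt p + g p.1)

theorem score_of_uncovered {gt : α → α → Prop} {g : α → ℤ} {N : Finset (α × α)} {v : α}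
    (h : ¬ ∃ p ∈ N, p.2 = v) : score gt g N v = 0 := by
  push Not at h
  rw [score, filter_false_of_mem h, sum_empty]

theorem IsPairing.score_eq {I J : Finset α} {N : Finset (α × α)} (hN : IsPairing I J N)
    (gt : α → α → Prop) (g : α → ℤ) {p : α × α} (hp : p ∈ N) :
    score gt g N p.2 = pairVote gt p + g p.1 := by
  have : (N.filter fun q => q.2 = p.2) = {p} := by
    ext q
    simp only [mem_filter, mem_singleton]
    exact ⟨fun h => hN.2.2 q h.1 p hp h.2, by rintro rfl; exact ⟨hp, rfl⟩⟩
  rw [score, this, sum_singleton]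

theorem IsPairing.neg_one_le_score {I J : Finset α} {N : Finset (α × α)} (hN : IsPairing I J N)
    (gt : α → α → Prop) {g : α → ℤ} (hg : ∀ u, 0 ≤ g u) (v : α) : -1 ≤ score gt g N v := by
  by_cases h : ∃ p ∈ N, p.2 = v
  · obtain ⟨p, hp, rfl⟩ := h
    rw [hN.score_eq gt g hp]
    linarith [neg_one_le_pairVote gt p, hg p.1]
  · rw [score_of_uncovered h]
    norm_num

theorem WeaklyFeasible.le_score {M : FinMatroid α} {I J : Finset α} {N : Finset (α × α)}
    (hN : WeaklyFeasible M I J N) {gt : α → α → Prop} {g : α → ℤ} {v : α} {k : ℤ}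
    (hv : v ∈ J \ I) (hdep : ¬ M.Indep (insert v I))
    (hk : ∀ u ∈ I, M.Indep (insert v (I.erase u)) → k ≤ pairVote gt (u, v) + g u) :
    k ≤ score gt g N v := by
  obtain ⟨p, hp, rfl⟩ := hN.2.2 v hv hdep
  rw [hN.1.score_eq gt g hp]
  exact hk p.1 (mem_sdiff.1 (hN.1.1 p hp).1).1 (hN.2.1 p hp)

theorem IsPairing.card_le {I J : Finset α} {N : Finset (α × α)} (hN : IsPairing I J N) :
    N.card ≤ (I \ J).card :=
  card_le_card_of_injOn Prod.fst (fun p hp => (hN.1 p hp).1)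
    fun p hp q hq h => hN.2.1 p hp q hq h

theorem IsPairing.sum_score_le {I J : Finset α} {N : Finset (α × α)} (hN : IsPairing I J N)
    (gt : α → α → Prop) {g : α → ℤ} (hg : ∀ u, 0 ≤ g u) :
    ∑ v ∈ J \ I, score gt g N v - ∑ u ∈ I \ J, g u + (I.card - J.card) ≤ voteN gt I J N := by
  have hscore : ∑ v ∈ J \ I, score gt g N v = ∑ p ∈ N, pairVote gt p + ∑ p ∈ N, g p.1 := by
    rw [← sum_add_distrib]
    exact sum_fiberwise_of_maps_to (fun p hp => (hN.1 p hp).2) _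
  have hgift : ∑ p ∈ N, g p.1 ≤ ∑ u ∈ I \ J, g u := by
    rw [← sum_image (f := g) (g := Prod.fst) fun p hp q hq h => hN.2.1 p hp q hq h]
    refine sum_le_sum_of_subset_of_nonneg (fun u hu => ?_) fun u _ _ => hg u
    obtain ⟨p, hp, rfl⟩ := mem_image.1 hu
    exact (hN.1 p hp).1
  have hvote : voteN gt I J N = ∑ p ∈ N, pairVote gt p + I.card - J.card := by
    simp [voteN, pairVote, sum_sub_distrib, sum_boole]
  linarith

/-- If the scores of each `v ∈ J \ I` total at least two, and more when `v` is uncovered in the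
first pairing, then `I` does not lose against `J`, and wins if `J` is larger. -/
theorem voteN_add_voteN_nonneg {gt₁ gt₂ : α → α → Prop} {I J : Finset α}
    {N₁ N₂ : Finset (α × α)} (hN₁ : IsPairing I J N₁) (hN₂ : IsPairing I J N₂)
    {g₁ g₂ : α → ℤ} (hg₁ : ∀ u, 0 ≤ g₁ u) (hg₂ : ∀ u, 0 ≤ g₂ u)
    (hg : ∀ u ∈ I, g₁ u + g₂ u = 2)
    (hscore : ∀ v ∈ J \ I, 2 ≤ score gt₁ g₁ N₁ v + score gt₂ g₂ N₂ v)
    (hstrict : ∀ v ∈ J \ I, (¬ ∃ p ∈ N₁, p.2 = v) →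
      2 < score gt₁ g₁ N₁ v + score gt₂ g₂ N₂ v) :
    0 ≤ voteN gt₁ I J N₁ + voteN gt₂ I J N₂ ∧
      (I.card < J.card → 0 < voteN gt₁ I J N₁ + voteN gt₂ I J N₂) := by
  have h₁ := hN₁.sum_score_le gt₁ hg₁
  have h₂ := hN₂.sum_score_le gt₂ hg₂
  have hgift : ∑ u ∈ I \ J, g₁ u + ∑ u ∈ I \ J, g₂ u = 2 * (I \ J).card := by
    rw [← sum_add_distrib, sum_congr rfl fun u hu => hg u (mem_sdiff.1 hu).1]
    simp [mul_comm]
  have hconst : ∑ _v ∈ J \ I, (2 : ℤ) = 2 * (J \ I).card := by simp [mul_comm]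
  have hI := card_sdiff_add_card_inter I J
  have hJ := card_sdiff_add_card_inter J I
  rw [inter_comm] at hJ
  have hadd := sum_add_distrib (s := J \ I) (f := score gt₁ g₁ N₁) (g := score gt₂ g₂ N₂)
  refine ⟨?_, fun hlt => ?_⟩
  · have := sum_le_sum hscore
    omega
  · obtain ⟨v, hv, hun⟩ : ∃ v ∈ J \ I, ¬ ∃ p ∈ N₁, p.2 = v := by
      by_contra! h
      have hsub : J \ I ⊆ N₁.image Prod.snd := fun v hv => mem_image.2 (h v hv)
      have := (card_le_card hsub).trans (card_image_le.trans hN₁.card_le)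
      omega
    have := sum_lt_sum hscore ⟨v, hv, hstrict v hv hun⟩
    omega

end Counting

/-- for any two ordered matroids `M₁`, `M₂` on the same finite ground set there
exists a common independent set `I` that is super popular
(`vote•₁(I,J) + vote•₂(I,J) ≥ 0` for all common independent `J`) and whose size is at least
that of every weakly defendable common independent set `J`
(`J` weakly defendable: `vote•₁(K,J) + vote•₂(K,J) ≤ 0` for all common independent `K`).
(`gtᵢ a b` means `a ≻ᵢ b`.) -/
theorem stmt_8 {α : Type*} [DecidableEq α] [Fintype α]
    (M₁ M₂ : FinMatroid α) (gt₁ gt₂ : α → α → Prop)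
    (h₁ : IsStrictTotalOrder α gt₁) (h₂ : IsStrictTotalOrder α gt₂) :
    ∃ I : Finset α, M₁.Indep I ∧ M₂.Indep I ∧
      (∀ J, M₁.Indep J → M₂.Indep J → 0 ≤ voteB M₁ gt₁ I J + voteB M₂ gt₂ I J) ∧
      (∀ J, M₁.Indep J → M₂.Indep J →
        (∀ K, M₁.Indep K → M₂.Indep K → voteB M₁ gt₁ K J + voteB M₂ gt₂ K J ≤ 0) →
        J.card ≤ I.card) := by
  obtain ⟨A, hA₁, hA₂, hstable⟩ := FinMatroid.exists_stable M₁.double M₂.double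
    (FinMatroid.doubleGt gt₁ false) (FinMatroid.doubleGt gt₂ true)
  let I := A.image Prod.fst
  let g : Bool → α → ℤ := fun l u => if (u, l) ∈ A then 2 else 0
  have hg0 : ∀ l u, 0 ≤ g l u := by
    intro l u
    simp only [g]
    split_ifs <;> norm_num
  have hgA : ∀ p ∈ A, ∀ l, g l p.1 = if p.2 = l then 2 else 0 := by
    rintro ⟨u, b⟩ hp l
    have : (u, l) ∈ A ↔ b = l :=
      ⟨fun h => (Prod.ext_iff.1 (hA₁.1 hp h rfl)).2, fun h => h ▸ hp⟩
    simp only [g, this]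
  have hg : ∀ u ∈ I, g false u + g true u = 2 := by
    intro u hu
    obtain ⟨⟨u, b⟩, hp, rfl⟩ := mem_image.1 hu
    rw [hgA _ hp, hgA _ hp]
    cases b <;> simp
  -- A dominated copy labelled `b` guarantees its element a score of 3 or 1.
  have hdom : ∀ (M : FinMatroid α) (gt : α → α → Prop) [IsStrictTotalOrder α gt] (l b : Bool)
      (J : Finset α) (N : Finset (α × α)) (v : α), M.double.Indep A → WeaklyFeasible M I J N →
      v ∈ J \ I → M.double.Dominates (FinMatroid.doubleGt gt l) A (v, b) →
      (if b = l then 3 else 1) ≤ score gt (g l) N v ∧ ∃ p ∈ N, p.2 = v := by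
    intro M gt _ l b J N v hA hN hv h
    obtain ⟨hdep, hbetter⟩ := FinMatroid.double_dominates hA (mem_sdiff.1 hv).2 h
    refine ⟨hN.le_score hv hdep fun u hu hind => ?_, hN.2.2 v hv hdep⟩
    obtain ⟨p, hp, rfl⟩ := mem_image.1 hu
    rw [hgA p hp]
    have hneg := neg_one_le_pairVote gt (p.1, v)
    have hpos := pairVote_of_gt (gt := gt) (p := (p.1, v))
    rcases hbetter p hp hind with ⟨hl, hb⟩ | ⟨hpb, hgt⟩
    · simp only at hb
      simp only [hl, hb, if_true, if_false]
      linarith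
    · simp only at hpb
      rw [hpos hgt, hpb]
      split_ifs <;> norm_num
  have main : ∀ J N₁ N₂, WeaklyFeasible M₁ I J N₁ → WeaklyFeasible M₂ I J N₂ →
      0 ≤ voteN gt₁ I J N₁ + voteN gt₂ I J N₂ ∧
        (I.card < J.card → 0 < voteN gt₁ I J N₁ + voteN gt₂ I J N₂) := by
    intro J N₁ N₂ hN₁ hN₂
    have hcases : ∀ v ∈ J \ I, 2 ≤ score gt₁ (g false) N₁ v + score gt₂ (g true) N₂ v ∧
        ((¬ ∃ p ∈ N₁, p.2 = v) → 2 < score gt₁ (g false) N₁ v + score gt₂ (g true) N₂ v) := by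
      intro v hv
      have hvA : ∀ b, (v, b) ∉ A := fun b h => (mem_sdiff.1 hv).2 (mem_image_of_mem Prod.fst h)
      have hs₁ := hN₁.1.neg_one_le_score gt₁ (hg0 false) v
      have hs₂ := hN₂.1.neg_one_le_score gt₂ (hg0 true) v
      have hun := score_of_uncovered (gt := gt₁) (g := g false) (N := N₁) (v := v)
      have hd₁ := fun b => hdom M₁ gt₁ false b J N₁ v hA₁ hN₁ hv
      have hd₂ := fun b => hdom M₂ gt₂ true b J N₂ v hA₂ hN₂ hv
      rcases hstable (v, false) (hvA _) with h | h
      · obtain ⟨h3, hc⟩ := hd₁ false h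
        simp only [if_true] at h3
        exact ⟨by linarith, fun h => absurd hc h⟩
      · have h1 := (hd₂ false h).1
        rcases hstable (v, true) (hvA _) with h' | h'
        · obtain ⟨h1', hc⟩ := hd₁ true h'
          simp only [Bool.false_eq_true, Bool.true_eq_false, if_false] at h1 h1'
          exact ⟨by linarith, fun h => absurd hc h⟩
        · have h3 := (hd₂ true h').1
          simp only [if_true] at h3
          exact ⟨by linarith, fun h => by linarith [hun h]⟩
    exact voteN_add_voteN_nonneg hN₁.1 hN₂.1 (hg0 false) (hg0 true) hg
      (fun v hv => (hcases v hv).1) fun v hv => (hcases v hv).2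
  refine ⟨I, hA₁.2, hA₂.2, fun J hJ₁ hJ₂ => ?_, fun J hJ₁ hJ₂ hdef => ?_⟩
  · obtain ⟨N₁, hN₁, e₁⟩ := M₁.exists_voteB_eq gt₁ hA₁.2 hJ₁
    obtain ⟨N₂, hN₂, e₂⟩ := M₂.exists_voteB_eq gt₂ hA₂.2 hJ₂
    rw [e₁, e₂]
    exact (main J N₁ N₂ hN₁ hN₂).1
  · obtain ⟨N₁, hN₁, e₁⟩ := M₁.exists_voteB_eq gt₁ hA₁.2 hJ₁
    obtain ⟨N₂, hN₂, e₂⟩ := M₂.exists_voteB_eq gt₂ hA₂.2 hJ₂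
    have hle := hdef I hA₁.2 hA₂.2
    rw [e₁, e₂] at hle
    by_contra! hlt
    exact absurd ((main J N₁ N₂ hN₁ hN₂).2 hlt) (not_lt.2 hle)

end
end

section
/- Let I = (G; ≻; b) be a b-matching instance with maximum capacity q, and let I' be the instance obtained from I by adding, for each agent v with b(v) = c < q, dummy agents d_1^v, …, d_{q−c}^v with capacity q, each adjacent only to v, where v's capacity is raised to q and v ranks its dummy edges above all its original edges. Let D be the set of all dummy edges. Then every b-matching μ' of I' that does not contain all edges of D fails to be lexicographically popular in I': there exists a b-matching μ'' of I' with vote_lex(μ'', μ') > 0. -/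
open Finset
open scoped Classical

noncomputable section

/-- A bipartite `b`-matching instance: left agents `U`, right agents `W`, edges `E` with
endpoint maps, capacities `cap`, and for each agent `a` a strict preference relation
`pref a e f` meaning `e ≻^a f` on the edges incident to `a`. -/
structure BInst (U W E : Type*) where
  left : E → U
  right : E → W
  cap : U ⊕ W → ℕ
  pref : U ⊕ W → E → E → Prop

variable {U W E : Type*}

/-- The edge `e` is incident to the agent `a`. -/
def BInst.incE (P : BInst U W E) (a : U ⊕ W) (e : E) : Prop :=
  match a with
  | Sum.inl u => P.left e = u
  | Sum.inr w => P.right e = w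

/-- `μ` is a `b`-matching: every agent `a` is incident to at most `cap a` edges of `μ`. -/
def BInst.IsBMatching [Fintype E] (P : BInst U W E) (μ : Finset E) : Prop :=
  ∀ a : U ⊕ W, (μ.filter fun e => P.incE a e).card ≤ P.cap a

/-- `μ` is lexicographically better than `μ'` for agent `a`: the set of incident edges in the
symmetric difference is nonempty and its `≻^a`-best element lies in `μ`. -/
def BInst.LexBetter (P : BInst U W E) (a : U ⊕ W) (μ μ' : Finset E) : Prop :=
  ∃ e ∈ μ \ μ', P.incE a e ∧
    ∀ f ∈ (μ ∪ μ') \ (μ ∩ μ'), P.incE a f → f ≠ e → P.pref a e f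

/-- The vote of agent `a` comparing `μ` to `μ'`: `+1`, `-1`, or `0`. -/
def BInst.voteAgent [DecidableEq E] (P : BInst U W E) (a : U ⊕ W) (μ μ' : Finset E) : ℤ :=
  if P.LexBetter a μ μ' then 1 else if P.LexBetter a μ' μ then -1 else 0

/-- `vote_lex(μ, μ')`: the sum of the votes of all agents. -/
def BInst.voteLex [DecidableEq E] [Fintype U] [Fintype W] (P : BInst U W E)
    (μ μ' : Finset E) : ℤ :=
  ∑ a : U ⊕ W, P.voteAgent a μ μ'

/-- `μ` is a lexicographically popular `b`-matching. -/
def BInst.LexPopular [DecidableEq E] [Fintype E] [Fintype U] [Fintype W] (P : BInst U W E)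
    (μ : Finset E) : Prop :=
  P.IsBMatching μ ∧ ∀ μ' : Finset E, P.IsBMatching μ' → 0 ≤ P.voteLex μ μ'

/-- The preferences of the instance form, for each agent, a strict linear order on its
incident edges (and compare only incident edges). -/
def BInst.GoodPref (P : BInst U W E) : Prop :=
  ∀ a : U ⊕ W,
    (∀ e, ¬ P.pref a e e) ∧
    (∀ e f g, P.pref a e f → P.pref a f g → P.pref a e g) ∧
    (∀ e f, P.incE a e → P.incE a f → e ≠ f → P.pref a e f ∨ P.pref a f e) ∧
    (∀ e f, P.pref a e f → P.incE a e ∧ P.incE a f)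

/-- The instance `I'` obtained from `P` by raising all capacities to `q`: every agent `v` with
capacity `c < q` receives `q - c` dummy neighbours `d_1^v, …, d_{q-c}^v` (of capacity `q`),
each adjacent only to `v`; `v` ranks its dummy edges `d_1^v ≻ ⋯ ≻ d_{q-c}^v` above all its
original edges.  Dummies of left agents are new right agents and vice versa; the edge
`Sum.inr (Sum.inl ⟨u, i⟩)` joins `u : U` to its `i`-th dummy, and `Sum.inr (Sum.inr ⟨w, i⟩)`
joins `w : W` to its `i`-th dummy. -/
def BInst.ext (P : BInst U W E) (q : ℕ) :
    BInst (U ⊕ (Σ w : W, Fin (q - P.cap (Sum.inr w))))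
      (W ⊕ (Σ u : U, Fin (q - P.cap (Sum.inl u))))
      (E ⊕ ((Σ u : U, Fin (q - P.cap (Sum.inl u))) ⊕
        (Σ w : W, Fin (q - P.cap (Sum.inr w))))) where
  left e :=
    match e with
    | .inl e => .inl (P.left e)
    | .inr (.inl d) => .inl d.1
    | .inr (.inr d) => .inr d
  right e :=
    match e with
    | .inl e => .inl (P.right e)
    | .inr (.inl d) => .inr d
    | .inr (.inr d) => .inl d.1
  cap _ := q
  pref a e f :=
    match a, e, f with
    | .inl (.inl u), .inl e, .inl f => P.pref (Sum.inl u) e f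
    | .inl (.inl u), .inr (.inl d), .inl f => d.1 = u ∧ P.left f = u
    | .inl (.inl u), .inr (.inl d), .inr (.inl d') =>
        d.1 = u ∧ d'.1 = u ∧ (d.2 : ℕ) < (d'.2 : ℕ)
    | .inr (.inl w), .inl e, .inl f => P.pref (Sum.inr w) e f
    | .inr (.inl w), .inr (.inr d), .inl f => d.1 = w ∧ P.right f = w
    | .inr (.inl w), .inr (.inr d), .inr (.inr d') =>
        d.1 = w ∧ d'.1 = w ∧ (d.2 : ℕ) < (d'.2 : ℕ)
    | _, _, _ => False

/-- The set `D` of all dummy edges of the extended instance. -/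
def dummyEdges (P : BInst U W E) (q : ℕ) [Fintype U] [Fintype W] [DecidableEq E]
    [DecidableEq U] [DecidableEq W] :
    Finset (E ⊕ ((Σ u : U, Fin (q - P.cap (Sum.inl u))) ⊕
      (Σ w : W, Fin (q - P.cap (Sum.inr w))))) :=
  Finset.univ.image Sum.inr

/-- Adding to a `b`-matching `μ` a missing edge `e` that is the only edge of its endpoint `d`,
and dropping a set `S` of edges that the other endpoint `v` ranks below `e` and that touch only
one further agent `w`, wins the vote against `μ`. -/
theorem BInst.exists_voteLex_pos_of_exchange [Fintype U] [Fintype W] [DecidableEq E] [Fintype E]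
    (Q : BInst U W E) {μ S : Finset E} {e : E} {v d w : U ⊕ W} (hμ : Q.IsBMatching μ)
    (he : e ∉ μ) (hvd : v ≠ d) (hve : Q.incE v e) (hde : Q.incE d e)
    (hends : ∀ a, Q.incE a e → a = v ∨ a = d) (hd : ∀ f, Q.incE d f → f = e)
    (hcapd : 1 ≤ Q.cap d) (hcapv : ((μ \ S).filter fun f => Q.incE v f).card < Q.cap v)
    (hS : ∀ f ∈ S, Q.pref v e f) (hSw : ∀ f ∈ S, ∀ a, Q.incE a f → a = v ∨ a = w) :
    ∃ μ'', Q.IsBMatching μ'' ∧ 0 < Q.voteLex μ'' μ := by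
  refine ⟨insert e (μ \ S), fun a => ?_, ?_⟩
  · by_cases hae : Q.incE a e
    · rcases hends a hae with rfl | rfl
      · rw [Finset.filter_insert, if_pos hae]
        exact (Finset.card_insert_le _ _).trans hcapv
      · refine le_trans (Finset.card_le_one.2 fun x hx y hy => ?_) hcapd
        rw [hd x (Finset.mem_filter.1 hx).2, hd y (Finset.mem_filter.1 hy).2]
    · rw [Finset.filter_insert, if_neg hae]
      exact (Finset.card_le_card
        (Finset.filter_subset_filter _ Finset.sdiff_subset)).trans (hμ a)
  · have hdiff : ∀ f, (f ∈ insert e (μ \ S) ∧ f ∉ μ) ∨ (f ∈ μ ∧ f ∉ insert e (μ \ S)) →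
        f = e ∨ f ∈ S := by
      intro f
      simp only [Finset.mem_insert, Finset.mem_sdiff]
      tauto
    have hbetter : ∀ a, a = v ∨ a = d → Q.LexBetter a (insert e (μ \ S)) μ := by
      intro a ha
      refine ⟨e, by simp [he], by rcases ha with rfl | rfl <;> assumption, fun f hf hfa hfe => ?_⟩
      rcases ha with rfl | rfl
      · refine hS f ((hdiff f ?_).resolve_left hfe)
        simp only [Finset.mem_sdiff, Finset.mem_union, Finset.mem_inter] at hf
        tauto
      · exact absurd (hd f hfa) hfe
    have hge : ∀ a, (if a = v then 1 else 0) + (if a = d then 1 else 0)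
        - (if a = w then 1 else 0) ≤ Q.voteAgent a (insert e (μ \ S)) μ := by
      intro a
      by_cases ha : a = v ∨ a = d
      · rw [BInst.voteAgent, if_pos (hbetter a ha)]
        rcases ha with rfl | rfl
        · rw [if_neg hvd]; split_ifs <;> simp
        · rw [if_neg hvd.symm]; split_ifs <;> simp
      · have ha' := not_or.1 ha
        rw [if_neg ha'.1, if_neg ha'.2]
        by_cases haw : a = w
        · unfold BInst.voteAgent; split_ifs <;> simp
        · have hworse : ¬ Q.LexBetter a μ (insert e (μ \ S)) := by
            rintro ⟨f, hf, hfa, -⟩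
            rcases hdiff f (Or.inr (by simpa only [Finset.mem_sdiff] using hf)) with rfl | hfS
            · exact ha (hends a hfa)
            · exact (hSw f hfS a hfa).elim ha'.1 haw
          rw [BInst.voteAgent, if_neg hworse]
          split_ifs <;> simp
    have hsum := Finset.sum_le_sum fun a (_ : a ∈ (Finset.univ : Finset (U ⊕ W))) => hge a
    simp only [Finset.sum_sub_distrib, Finset.sum_add_distrib, Finset.sum_ite_eq',
      Finset.mem_univ, if_true] at hsum
    exact lt_of_lt_of_le (by norm_num) hsum

/-- A finset that avoids one value `g i` of `g : Fin k → E` and consists of values of `g` has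
fewer than `k` elements. -/
theorem Finset.card_lt_of_forall_mem_range_of_notMem {E : Type*} {k : ℕ} {g : Fin k → E}
    {s : Finset E} (hs : ∀ f ∈ s, ∃ j, f = g j) {i : Fin k} (hi : g i ∉ s) : s.card < k := by
  have hss : s ⊂ Finset.univ.image g := by
    refine (Finset.ssubset_iff_of_subset fun f hf => ?_).2 ⟨g i, by simp, hi⟩
    obtain ⟨j, rfl⟩ := hs f hf
    simp
  exact (Finset.card_lt_card hss).trans_le (Finset.card_image_le.trans (by simp))

/-- in the extended instance `P.ext q` (all capacities raised to the maximum
capacity `q` via dummy agents), every `b`-matching `μ'` that does not contain all dummy edges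
fails to be lexicographically popular: some `b`-matching `μ''` satisfies
`vote_lex(μ'', μ') > 0`. -/
theorem stmt_14 [Fintype U] [Fintype W] [DecidableEq U] [DecidableEq W]
    [DecidableEq E] [Fintype E]
    (P : BInst U W E) (q : ℕ)
    (hcap : ∀ a : U ⊕ W, P.cap a ≤ q) (hmax : ∃ a : U ⊕ W, P.cap a = q)
    (hpref : P.GoodPref)
    (μ' : Finset (E ⊕ ((Σ u : U, Fin (q - P.cap (Sum.inl u))) ⊕
      (Σ w : W, Fin (q - P.cap (Sum.inr w))))))
    (hμ' : (P.ext q).IsBMatching μ')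
    (hD : ¬ dummyEdges P q ⊆ μ') :
    ∃ μ'', (P.ext q).IsBMatching μ'' ∧ 0 < (P.ext q).voteLex μ'' μ' := by
  obtain ⟨e, heD, he⟩ := Finset.not_subset.1 hD
  obtain ⟨⟨u, i⟩ | ⟨w, i⟩, -, rfl⟩ := Finset.mem_image.1 heD
  · have hlt : 1 ≤ q := by have := i.isLt; omega
    have hends : ∀ a, (P.ext q).incE a (.inr (.inl ⟨u, i⟩)) →
        a = .inl (.inl u) ∨ a = .inr (.inr ⟨u, i⟩) := by
      rintro (a | a) ha
      · left; exact congrArg _ ha.symm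
      · right; exact congrArg _ ha.symm
    have hd : ∀ f, (P.ext q).incE (.inr (.inr ⟨u, i⟩)) f → f = .inr (.inl ⟨u, i⟩) := by
      rintro (f | f | f) hf <;> simp only [BInst.incE, BInst.ext, reduceCtorEq] at hf
      exact congrArg _ (congrArg _ (Sum.inr_injective hf))
    by_cases h : ∃ f, .inl f ∈ μ' ∧ P.left f = u
    · obtain ⟨f, hfμ, hf⟩ := h
      refine (P.ext q).exists_voteLex_pos_of_exchange (S := {.inl f})
        (v := .inl (.inl u)) (d := .inr (.inr ⟨u, i⟩))
        (w := .inr (.inl (P.right f))) hμ' he (by simp) rfl rfl hends hd hlt ?_ ?_ ?_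
      · refine (Finset.card_lt_card ?_).trans_le (hμ' (.inl (.inl u)))
        refine (Finset.ssubset_iff_of_subset
          (Finset.filter_subset_filter _ Finset.sdiff_subset)).2 ⟨.inl f, ?_, by simp⟩
        exact Finset.mem_filter.2 ⟨hfμ, congrArg Sum.inl hf⟩
      · simpa [BInst.ext] using hf
      · simp only [Finset.mem_singleton, forall_eq]
        rintro (a | a) ha
        · left; exact congrArg Sum.inl (ha.symm.trans (congrArg Sum.inl hf))
        · right; exact congrArg _ ha.symm
    · refine (P.ext q).exists_voteLex_pos_of_exchange (S := ∅)
        (v := .inl (.inl u)) (d := .inr (.inr ⟨u, i⟩))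
        (w := .inl (.inl u)) hμ' he (by simp) rfl rfl hends hd hlt ?_ (by simp) (by simp)
      refine (Finset.card_lt_of_forall_mem_range_of_notMem
        (g := fun j => .inr (.inl ⟨u, j⟩)) (fun f hf => ?_) (i := i) ?_).trans_le
        (Nat.sub_le q (P.cap (.inl u)))
      · simp only [Finset.sdiff_empty, Finset.mem_filter] at hf
        obtain ⟨hfμ, hf⟩ := hf
        rcases f with f | ⟨x, j⟩ | ⟨x, j⟩ <;>
          simp only [BInst.incE, BInst.ext, Sum.inl.injEq, reduceCtorEq] at hf
        · exact absurd ⟨f, hfμ, hf⟩ h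
        · subst hf; exact ⟨j, rfl⟩
      · simpa using fun h => absurd h he
  · have hlt : 1 ≤ q := by have := i.isLt; omega
    have hends : ∀ a, (P.ext q).incE a (.inr (.inr ⟨w, i⟩)) →
        a = .inr (.inl w) ∨ a = .inl (.inr ⟨w, i⟩) := by
      rintro (a | a) ha
      · right; exact congrArg _ ha.symm
      · left; exact congrArg _ ha.symm
    have hd : ∀ f, (P.ext q).incE (.inl (.inr ⟨w, i⟩)) f → f = .inr (.inr ⟨w, i⟩) := by
      rintro (f | f | f) hf <;> simp only [BInst.incE, BInst.ext, reduceCtorEq] at hf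
      exact congrArg _ (congrArg _ (Sum.inr_injective hf))
    by_cases h : ∃ f, .inl f ∈ μ' ∧ P.right f = w
    · obtain ⟨f, hfμ, hf⟩ := h
      refine (P.ext q).exists_voteLex_pos_of_exchange (S := {.inl f})
        (v := .inr (.inl w)) (d := .inl (.inr ⟨w, i⟩))
        (w := .inl (.inl (P.left f))) hμ' he (by simp) rfl rfl hends hd hlt ?_ ?_ ?_
      · refine (Finset.card_lt_card ?_).trans_le (hμ' (.inr (.inl w)))
        refine (Finset.ssubset_iff_of_subset
          (Finset.filter_subset_filter _ Finset.sdiff_subset)).2 ⟨.inl f, ?_, by simp⟩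
        exact Finset.mem_filter.2 ⟨hfμ, congrArg Sum.inl hf⟩
      · simpa [BInst.ext] using hf
      · simp only [Finset.mem_singleton, forall_eq]
        rintro (a | a) ha
        · right; exact congrArg _ ha.symm
        · left; exact congrArg Sum.inr (ha.symm.trans (congrArg Sum.inl hf))
    · refine (P.ext q).exists_voteLex_pos_of_exchange (S := ∅)
        (v := .inr (.inl w)) (d := .inl (.inr ⟨w, i⟩))
        (w := .inr (.inl w)) hμ' he (by simp) rfl rfl hends hd hlt ?_ (by simp) (by simp)
      refine (Finset.card_lt_of_forall_mem_range_of_notMem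
        (g := fun j => .inr (.inr ⟨w, j⟩)) (fun f hf => ?_) (i := i) ?_).trans_le
        (Nat.sub_le q (P.cap (.inr w)))
      · simp only [Finset.sdiff_empty, Finset.mem_filter] at hf
        obtain ⟨hfμ, hf⟩ := hf
        rcases f with f | ⟨x, j⟩ | ⟨x, j⟩ <;>
          simp only [BInst.incE, BInst.ext, Sum.inl.injEq, reduceCtorEq] at hf
        · exact absurd ⟨f, hfμ, hf⟩ h
        · subst hf; exact ⟨j, rfl⟩
      · simpa using fun h => absurd h he

end
end
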